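/- arXiv:1207.3949 — 6 statements merged into one kernel-verified Lean document; each statement's English description precedes it below -/
import Mathlib

section
/- Let (X,ρ) be a metric space, let A_0,A_1,…,A_n be points with A_0≠A_n, ρ(A_{i−1},A_i) = ρ(A_0,A_n)/n for each i ∈ {1,…,n}, and such that each A_i lies metrically between A_0 and A_n with ρ(A_0,A_i) = (i/n)·ρ(A_0,A_n); let C_0,C_1,…,C_m be points with C_0≠C_m, ρ(C_{j−1},C_j) = ρ(C_0,C_m)/m, and ρ(C_0,C_j) = (j/m)·ρ(C_0,C_m) with each C_j lying metrically between C_0 and C_m. Then h(A_0,A_n;C_0,C_m) = (1/(n·m)) · Σ_{i=1}^{n} Σ_{j=1}^{m} h(A_{i−1},A_i;C_{j−1},C_j). -/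
/-- The quadrilateral function `h(A,B;C,D)` of four points of a metric space. -/
noncomputable def quadH {X : Type*} [MetricSpace X] (A B C D : X) : ℝ :=
  (Real.cos (dist A C) + Real.cos (dist B D) - Real.cos (dist A D) - Real.cos (dist B C)) /
    (dist A B * dist C D)

theorem telescope_Icc (g : ℕ → ℝ) (n : ℕ) :
    ∑ i ∈ Finset.Icc 1 n, (g i - g (i - 1)) = g n - g 0 := by
  induction n with
  | zero => simp
  | succ k ih =>
    rw [Finset.sum_Icc_succ_top (by omega), ih]
    simp

/-- Additivity of the quadrilateral function with respect to equidistant subdivisions of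
the segments `[A_0, A_n]` and `[C_0, C_m]`. -/
theorem quadH_sum {X : Type*} [MetricSpace X] (n m : ℕ) (hn : 1 ≤ n) (hm : 1 ≤ m)
    (A C : ℕ → X)
    (hA : A 0 ≠ A n) (hC : C 0 ≠ C m)
    (hAstep : ∀ i ∈ Finset.Icc 1 n, dist (A (i - 1)) (A i) = dist (A 0) (A n) / n)
    (hAbetween : ∀ i ∈ Finset.Icc 1 n, dist (A 0) (A i) + dist (A i) (A n) = dist (A 0) (A n))
    (hApos : ∀ i ∈ Finset.Icc 1 n, dist (A 0) (A i) = (i / n : ℝ) * dist (A 0) (A n))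
    (hCstep : ∀ j ∈ Finset.Icc 1 m, dist (C (j - 1)) (C j) = dist (C 0) (C m) / m)
    (hCbetween : ∀ j ∈ Finset.Icc 1 m, dist (C 0) (C j) + dist (C j) (C m) = dist (C 0) (C m))
    (hCpos : ∀ j ∈ Finset.Icc 1 m, dist (C 0) (C j) = (j / m : ℝ) * dist (C 0) (C m)) :
    quadH (A 0) (A n) (C 0) (C m) =
      (1 / (n * m : ℝ)) *
        ∑ i ∈ Finset.Icc 1 n, ∑ j ∈ Finset.Icc 1 m,
          quadH (A (i - 1)) (A i) (C (j - 1)) (C j) := by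
  have hn0 : (n : ℝ) ≠ 0 := by positivity
  have hm0 : (m : ℝ) ≠ 0 := by positivity
  have ha : dist (A 0) (A n) ≠ 0 := dist_ne_zero.mpr hA
  have hc : dist (C 0) (C m) ≠ 0 := dist_ne_zero.mpr hC
  have key : ∀ i ∈ Finset.Icc 1 n, ∑ j ∈ Finset.Icc 1 m,
      quadH (A (i - 1)) (A i) (C (j - 1)) (C j) =
      ((Real.cos (dist (A i) (C m)) - Real.cos (dist (A i) (C 0))) -
        (Real.cos (dist (A (i - 1)) (C m)) - Real.cos (dist (A (i - 1)) (C 0)))) /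
      (dist (A 0) (A n) / n * (dist (C 0) (C m) / m)) := by
    intro i hi
    have h := telescope_Icc
      (fun j => Real.cos (dist (A i) (C j)) - Real.cos (dist (A (i - 1)) (C j))) m
    have e : ∀ j ∈ Finset.Icc 1 m, quadH (A (i - 1)) (A i) (C (j - 1)) (C j) =
        ((Real.cos (dist (A i) (C j)) - Real.cos (dist (A (i - 1)) (C j))) -
        (Real.cos (dist (A i) (C (j - 1))) - Real.cos (dist (A (i - 1)) (C (j - 1))))) /
        (dist (A 0) (A n) / n * (dist (C 0) (C m) / m)) := by
      intro j hj
      rw [quadH, hAstep i hi, hCstep j hj]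
      congr 1
      ring
    rw [Finset.sum_congr rfl e, ← Finset.sum_div, h]
    congr 1
    ring
  have h := telescope_Icc
    (fun i => Real.cos (dist (A i) (C m)) - Real.cos (dist (A i) (C 0))) n
  rw [Finset.sum_congr rfl key, ← Finset.sum_div, h, quadH]
  field_simp
  ring
end

section
/- Let x₁, x₂, x₃, x₄ be four distinct unit vectors in ℝ³, with spherical distance d(x,y) = arccos⟨x,y⟩, such that d(x_i,x_j) < π/2 for all i,j, and such that x₃ lies on a minimal geodesic from x₂ to x₄, i.e. d(x₂,x₃)+d(x₃,x₄)=d(x₂,x₄). Then cos d(x₁,x₃) · sin d(x₂,x₄) = cos d(x₁,x₄) · sin d(x₂,x₃) + cos d(x₁,x₂) · sin d(x₃,x₄). -/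
open Real RealInnerProductSpace

/-- The spherical distance between two (unit) vectors of Euclidean `ℝ³`. -/
noncomputable def sphDist (x y : EuclideanSpace ℝ (Fin 3)) : ℝ :=
  Real.arccos ⟪x, y⟫

/-- Spherical cosine-law identity for four points of the unit sphere with `x₃` on a minimal
geodesic from `x₂` to `x₄`. -/
theorem sph_cos_identity (x₁ x₂ x₃ x₄ : EuclideanSpace ℝ (Fin 3))
    (h₁ : ‖x₁‖ = 1) (h₂ : ‖x₂‖ = 1) (h₃ : ‖x₃‖ = 1) (h₄ : ‖x₄‖ = 1)
    (h₁₂ : x₁ ≠ x₂) (h₁₃ : x₁ ≠ x₃) (h₁₄ : x₁ ≠ x₄)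
    (h₂₃ : x₂ ≠ x₃) (h₂₄ : x₂ ≠ x₄) (h₃₄ : x₃ ≠ x₄)
    (hd₁₂ : sphDist x₁ x₂ < π / 2) (hd₁₃ : sphDist x₁ x₃ < π / 2)
    (hd₁₄ : sphDist x₁ x₄ < π / 2) (hd₂₃ : sphDist x₂ x₃ < π / 2)
    (hd₂₄ : sphDist x₂ x₄ < π / 2) (hd₃₄ : sphDist x₃ x₄ < π / 2)
    (hbetween : sphDist x₂ x₃ + sphDist x₃ x₄ = sphDist x₂ x₄) :
    Real.cos (sphDist x₁ x₃) * Real.sin (sphDist x₂ x₄) =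
      Real.cos (sphDist x₁ x₄) * Real.sin (sphDist x₂ x₃) +
        Real.cos (sphDist x₁ x₂) * Real.sin (sphDist x₃ x₄) := by
  have key : ∀ x y : EuclideanSpace ℝ (Fin 3), ‖x‖ = 1 → ‖y‖ = 1 →
      Real.cos (sphDist x y) = ⟪x, y⟫ := by
    intro x y hx hy
    have h := abs_le.mp (abs_real_inner_le_norm x y)
    rw [hx, hy] at h
    exact Real.cos_arccos (by linarith [h.1]) (by linarith [h.2])
  have k13 := key x₁ x₃ h₁ h₃
  have k14 := key x₁ x₄ h₁ h₄
  have k12 := key x₁ x₂ h₁ h₂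
  have k23 := key x₂ x₃ h₂ h₃
  have k34 := key x₃ x₄ h₃ h₄
  have k24 := key x₂ x₄ h₂ h₄
  rw [← hbetween] at k24 ⊢
  rw [k13, k14, k12]
  generalize sphDist x₂ x₃ = a at *
  generalize sphDist x₃ x₄ = b at *
  have hv : Real.sin (a + b) • x₃ - Real.sin a • x₄ - Real.sin b • x₂ = 0 := by
    rw [← inner_self_eq_zero (𝕜 := ℝ)]
    simp only [inner_sub_left, inner_sub_right, real_inner_smul_left, real_inner_smul_right]
    simp only [real_inner_self_eq_norm_sq, h₂, h₃, h₄]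
    rw [real_inner_comm x₃ x₄, real_inner_comm x₂ x₄, real_inner_comm x₂ x₃,
      ← k23, ← k34, ← k24, Real.sin_add, Real.cos_add]
    have ha := Real.sin_sq_add_cos_sq a
    have hb := Real.sin_sq_add_cos_sq b
    have ha' : Real.cos a ^ 2 = 1 - Real.sin a ^ 2 := by linarith
    have hb' : Real.cos b ^ 2 = 1 - Real.sin b ^ 2 := by linarith
    ring_nf
    rw [ha', hb']
    ring
  have h := congrArg (fun v => ⟪x₁, v⟫) hv
  simp only [inner_sub_right, real_inner_smul_right, inner_zero_right] at h
  linarith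
end

section
/- Let x₁, x₂, x₃, x₄ be four distinct unit vectors in ℝ³, with spherical distance d(x,y) = arccos⟨x,y⟩, such that d(x_i,x_j) < π/2 for all i,j, and such that x₃ lies on a minimal geodesic from x₂ to x₄, i.e. d(x₂,x₃)+d(x₃,x₄)=d(x₂,x₄). Then sin²(d(x₁,x₃)/2) ≤ (d(x₂,x₃)/d(x₂,x₄))·sin²(d(x₁,x₄)/2) + (d(x₃,x₄)/d(x₂,x₄))·sin²(d(x₁,x₂)/2). -/
open Real RealInnerProductSpace

theorem sph_aux_sin {a b : ℝ} (ha : 0 ≤ a) (hb : 0 ≤ b) (hab : 0 < a + b) (hp : a + b ≤ π) :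
    a / (a + b) * Real.sin (a + b) ≤ Real.sin a := by
  have h := strictConcaveOn_sin_Icc.concaveOn.2 (show a + b ∈ Set.Icc 0 π from ⟨hab.le, hp⟩)
    (show (0 : ℝ) ∈ Set.Icc 0 π from ⟨le_rfl, Real.pi_pos.le⟩)
    (show 0 ≤ a / (a + b) by positivity) (show 0 ≤ b / (a + b) by positivity)
    (by field_simp)
  simp only [smul_eq_mul, Real.sin_zero, mul_zero, add_zero] at h
  rwa [div_mul_cancel₀ _ hab.ne'] at h

theorem sph_aux_sq (x y : EuclideanSpace ℝ (Fin 3)) (hx : ‖x‖ = 1) (hy : ‖y‖ = 1) :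
    Real.cos (sphDist x y) = ⟪x, y⟫ := by
  have h := abs_real_inner_le_norm x y
  rw [hx, hy, mul_one, abs_le] at h
  exact Real.cos_arccos h.1 h.2

theorem sph_aux_half (t : ℝ) : Real.sin (t / 2) ^ 2 = (1 - Real.cos t) / 2 := by
  rw [Real.sin_sq, Real.cos_sq]
  ring_nf

theorem sph_aux_pos (x y : EuclideanSpace ℝ (Fin 3)) (hx : ‖x‖ = 1) (hy : ‖y‖ = 1)
    (hne : x ≠ y) : 0 < sphDist x y := by
  unfold sphDist
  rw [Real.arccos_pos]
  exact (inner_lt_one_iff_real_of_norm_eq_one hx hy).2 hne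

/-- Lemma 3.1: a convexity-type inequality for `sin²(d/2)` on the unit sphere, for `x₃`
on a minimal geodesic from `x₂` to `x₄`. -/
theorem sph_sin_sq_convexity (x₁ x₂ x₃ x₄ : EuclideanSpace ℝ (Fin 3))
    (h₁ : ‖x₁‖ = 1) (h₂ : ‖x₂‖ = 1) (h₃ : ‖x₃‖ = 1) (h₄ : ‖x₄‖ = 1)
    (h₁₂ : x₁ ≠ x₂) (h₁₃ : x₁ ≠ x₃) (h₁₄ : x₁ ≠ x₄)
    (h₂₃ : x₂ ≠ x₃) (h₂₄ : x₂ ≠ x₄) (h₃₄ : x₃ ≠ x₄)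
    (hd₁₂ : sphDist x₁ x₂ < π / 2) (hd₁₃ : sphDist x₁ x₃ < π / 2)
    (hd₁₄ : sphDist x₁ x₄ < π / 2) (hd₂₃ : sphDist x₂ x₃ < π / 2)
    (hd₂₄ : sphDist x₂ x₄ < π / 2) (hd₃₄ : sphDist x₃ x₄ < π / 2)
    (hbetween : sphDist x₂ x₃ + sphDist x₃ x₄ = sphDist x₂ x₄) :
    Real.sin (sphDist x₁ x₃ / 2) ^ 2 ≤
      (sphDist x₂ x₃ / sphDist x₂ x₄) * Real.sin (sphDist x₁ x₄ / 2) ^ 2 +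
        (sphDist x₃ x₄ / sphDist x₂ x₄) * Real.sin (sphDist x₁ x₂ / 2) ^ 2 := by
  have c12 := sph_aux_sq x₁ x₂ h₁ h₂
  have c13 := sph_aux_sq x₁ x₃ h₁ h₃
  have c14 := sph_aux_sq x₁ x₄ h₁ h₄
  have c23 := sph_aux_sq x₂ x₃ h₂ h₃
  have c34 := sph_aux_sq x₃ x₄ h₃ h₄
  have c24 := sph_aux_sq x₂ x₄ h₂ h₄
  have p23 := sph_aux_pos x₂ x₃ h₂ h₃ h₂₃
  have p34 := sph_aux_pos x₃ x₄ h₃ h₄ h₃₄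
  have n12 : 0 < ⟪x₁, x₂⟫ := Real.arccos_lt_pi_div_two.1 hd₁₂
  have n14 : 0 < ⟪x₁, x₄⟫ := Real.arccos_lt_pi_div_two.1 hd₁₄
  rw [sph_aux_half, sph_aux_half, sph_aux_half, c12, c13, c14]
  rw [← hbetween] at hd₂₄ c24 ⊢
  generalize sphDist x₂ x₃ = a at *
  generalize sphDist x₃ x₄ = b at *
  have hpi := Real.pi_pos
  have hS : 0 < Real.sin (a + b) := Real.sin_pos_of_pos_of_lt_pi (by linarith) (by linarith)
  have e1 := sph_aux_sin p23.le p34.le (by linarith) (by linarith)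
  have e2 := sph_aux_sin p34.le p23.le (by linarith) (by linarith)
  rw [add_comm b a] at e2
  have key : Real.sin (a + b) • x₃ - (Real.sin a • x₄ + Real.sin b • x₂) = 0 := by
    rw [← inner_self_eq_zero (𝕜 := ℝ)]
    have q2 : ⟪x₂, x₂⟫ = 1 := by rw [real_inner_self_eq_norm_sq, h₂, one_pow]
    have q3 : ⟪x₃, x₃⟫ = 1 := by rw [real_inner_self_eq_norm_sq, h₃, one_pow]
    have q4 : ⟪x₄, x₄⟫ = 1 := by rw [real_inner_self_eq_norm_sq, h₄, one_pow]
    have r1 : ⟪x₃, x₂⟫ = ⟪x₂, x₃⟫ := real_inner_comm _ _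
    have r2 : ⟪x₄, x₃⟫ = ⟪x₃, x₄⟫ := real_inner_comm _ _
    have r3 : ⟪x₄, x₂⟫ = ⟪x₂, x₄⟫ := real_inner_comm _ _
    simp only [inner_sub_left, inner_sub_right, inner_add_left, inner_add_right,
      real_inner_smul_left, real_inner_smul_right, q2, q3, q4, r1, r2, r3]
    rw [← c23, ← c34, ← c24, Real.sin_add, Real.cos_add]
    have ia := Real.sin_sq_add_cos_sq a
    have ib := Real.sin_sq_add_cos_sq b
    have ia' : Real.cos a ^ 2 = 1 - Real.sin a ^ 2 := by linarith
    have ib' : Real.cos b ^ 2 = 1 - Real.sin b ^ 2 := by linarith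
    ring_nf
    rw [ia', ib']
    ring
  have hin : Real.sin (a + b) * ⟪x₁, x₃⟫ = Real.sin a * ⟪x₁, x₄⟫ + Real.sin b * ⟪x₁, x₂⟫ := by
    rw [← real_inner_smul_right, sub_eq_zero.1 key, inner_add_right, real_inner_smul_right,
      real_inner_smul_right]
  have hsum : a / (a + b) + b / (a + b) = 1 := by
    field_simp
  have hfin : a / (a + b) * ⟪x₁, x₄⟫ + b / (a + b) * ⟪x₁, x₂⟫ ≤ ⟪x₁, x₃⟫ := by
    refine le_of_mul_le_mul_left ?_ hS
    rw [hin]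
    have m1 := mul_le_mul_of_nonneg_right e1 n14.le
    have m2 := mul_le_mul_of_nonneg_right e2 n12.le
    linarith
  linarith
end

section
/- Let A, B, C be unit vectors in ℝ³ whose pairwise spherical distances d(x,y) = arccos⟨x,y⟩ are all at most M, where 0 < M ≤ π/2. Let t ∈ (0,1), and let D and E be unit vectors such that D lies on a minimal geodesic from A to C with d(D,C) = (1−t)·d(A,C), and E lies on a minimal geodesic from B to C with d(E,C) = (1−t)·d(B,C). Then d(D,E) ≤ (sin((1−t)M)/sin M) · d(A,B). -/
open Real RealInnerProductSpace

theorem aux_sin_concave {k x : ℝ} (hk0 : 0 ≤ k) (hk1 : k ≤ 1) (hx0 : 0 ≤ x) (hx : x ≤ π) :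
    k * Real.sin x ≤ Real.sin (k * x) := by
  have h := strictConcaveOn_sin_Icc.concaveOn.2 (x := x) ⟨hx0, hx⟩ (y := 0)
    ⟨le_refl _, Real.pi_pos.le⟩ hk0 (sub_nonneg.2 hk1) (by ring)
  simpa using h

theorem aux_num {s x : ℝ} (hs0 : 0 ≤ s) (hs1 : s ≤ 1) (hx0 : 0 ≤ x) (hx : x ≤ π) :
    Real.sin (s * x) * Real.cos x ≤ s * Real.cos (s * x) * Real.sin x := by
  have hd : ∀ y : ℝ, HasDerivAt
      (fun y => s * Real.cos (s * y) * Real.sin y - Real.sin (s * y) * Real.cos y)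
      ((1 - s ^ 2) * (Real.sin (s * y) * Real.sin y)) y := by
    intro y
    have h1 : HasDerivAt (fun y : ℝ => s * y) s y := by
      simpa using (hasDerivAt_id y).const_mul s
    have h2 := ((h1.cos.const_mul s).mul (Real.hasDerivAt_sin y)).sub
      (h1.sin.mul (Real.hasDerivAt_cos y))
    refine h2.congr_deriv ?_
    ring
  have hm : MonotoneOn
      (fun y => s * Real.cos (s * y) * Real.sin y - Real.sin (s * y) * Real.cos y)
      (Set.Icc 0 π) := by
    apply monotoneOn_of_deriv_nonneg (convex_Icc 0 π)
    · exact fun y _ => (hd y).continuousAt.continuousWithinAt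
    · exact fun y _ => (hd y).differentiableAt.differentiableWithinAt
    · intro y hy
      rw [interior_Icc] at hy
      rw [(hd y).deriv]
      have h1 : 0 ≤ Real.sin y := Real.sin_nonneg_of_nonneg_of_le_pi hy.1.le hy.2.le
      have h2 : 0 ≤ Real.sin (s * y) := Real.sin_nonneg_of_nonneg_of_le_pi
        (mul_nonneg hs0 hy.1.le) (by nlinarith [hy.1, hy.2])
      have : 0 ≤ 1 - s ^ 2 := by nlinarith
      positivity
  have h := hm (a := 0) ⟨le_refl _, Real.pi_pos.le⟩ (b := x) ⟨hx0, hx⟩ hx0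
  simp at h
  linarith

theorem aux_ratio {s a M : ℝ} (hs0 : 0 ≤ s) (hs1 : s ≤ 1) (ha : 0 ≤ a) (haM : a ≤ M)
    (hM0 : 0 < M) (hM : M ≤ π / 2) :
    Real.sin (s * a) ≤ Real.sin (s * M) / Real.sin M * Real.sin a := by
  have hpi := Real.pi_pos
  rcases ha.eq_or_lt with rfl | ha
  · simp
  have hsin : ∀ y ∈ Set.Ioc 0 (π / 2), 0 < Real.sin y := fun y hy =>
    Real.sin_pos_of_pos_of_lt_pi hy.1 (by linarith [hy.2])
  have hd : ∀ y ∈ Set.Ioc 0 (π / 2), HasDerivAt (fun y => Real.sin (s * y) / Real.sin y)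
      ((s * Real.cos (s * y) * Real.sin y - Real.sin (s * y) * Real.cos y) / Real.sin y ^ 2)
      y := by
    intro y hy
    have h1 : HasDerivAt (fun y : ℝ => s * y) s y := by
      simpa using (hasDerivAt_id y).const_mul s
    refine (h1.sin.div (Real.hasDerivAt_sin y) (hsin y hy).ne').congr_deriv ?_
    ring
  have hm : MonotoneOn (fun y => Real.sin (s * y) / Real.sin y) (Set.Ioc 0 (π / 2)) := by
    apply monotoneOn_of_deriv_nonneg (convex_Ioc 0 (π / 2))
    · exact fun y hy => (hd y hy).continuousAt.continuousWithinAt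
    · exact fun y hy => (hd y (interior_subset hy)).differentiableAt.differentiableWithinAt
    · intro y hy
      have hy := interior_subset hy
      rw [(hd y hy).deriv]
      apply div_nonneg _ (sq_nonneg _)
      have := aux_num hs0 hs1 hy.1.le (by linarith [hy.2] : y ≤ π)
      linarith
  have h := hm (a := a) ⟨ha, haM.trans hM⟩ (b := M) ⟨hM0, hM⟩ haM
  exact (div_le_iff₀ (hsin a ⟨ha, haM.trans hM⟩)).1 h

theorem aux_F {k x y : ℝ} (hk0 : 0 ≤ k) (hk1 : k ≤ 1) (hx : 0 ≤ x) (hxy : x ≤ y) (hy : y ≤ π) :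
    Real.cos (k * y) - k ^ 2 * Real.cos y ≤ Real.cos (k * x) - k ^ 2 * Real.cos x := by
  have hd : ∀ y : ℝ, HasDerivAt (fun y => Real.cos (k * y) - k ^ 2 * Real.cos y)
      (-(k * (Real.sin (k * y) - k * Real.sin y))) y := by
    intro y
    have h1 : HasDerivAt (fun y : ℝ => k * y) k y := by
      simpa using (hasDerivAt_id y).const_mul k
    refine (h1.cos.sub ((Real.hasDerivAt_cos y).const_mul (k ^ 2))).congr_deriv ?_
    ring
  have hm : AntitoneOn (fun y => Real.cos (k * y) - k ^ 2 * Real.cos y) (Set.Icc 0 π) := by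
    apply antitoneOn_of_deriv_nonpos (convex_Icc 0 π)
    · exact fun y _ => (hd y).continuousAt.continuousWithinAt
    · exact fun y _ => (hd y).differentiableAt.differentiableWithinAt
    · intro y hy
      have hy := interior_subset hy
      rw [(hd y).deriv]
      have := aux_sin_concave hk0 hk1 hy.1 hy.2
      have := mul_nonneg hk0 (sub_nonneg.2 this)
      linarith
  exact hm (a := x) ⟨hx, hxy.trans hy⟩ (b := y) ⟨hx.trans hxy, hy⟩ hxy

theorem aux_cos_sphDist {x y : EuclideanSpace ℝ (Fin 3)} (hx : ‖x‖ = 1) (hy : ‖y‖ = 1) :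
    Real.cos (sphDist x y) = ⟪x, y⟫ := by
  have h := abs_le.1 (abs_real_inner_le_norm x y)
  rw [hx, hy] at h
  exact Real.cos_arccos (by linarith [h.1]) (by linarith [h.2])

theorem aux_decomp (A C D : EuclideanSpace ℝ (Fin 3)) (s : ℝ)
    (hA : ‖A‖ = 1) (hC : ‖C‖ = 1) (hD : ‖D‖ = 1) (hb : sphDist A C ≤ π / 2)
    (hgeo : sphDist A D + sphDist D C = sphDist A C)
    (hdist : sphDist D C = s * sphDist A C) :
    ∃ U : EuclideanSpace ℝ (Fin 3), ‖U‖ ≤ 1 ∧ ⟪U, C⟫ = 0 ∧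
      A = Real.cos (sphDist A C) • C + Real.sin (sphDist A C) • U ∧
      D = Real.cos (s * sphDist A C) • C + Real.sin (s * sphDist A C) • U := by
  have hAC := aux_cos_sphDist hA hC
  have hDC := aux_cos_sphDist hD hC
  have hAD := aux_cos_sphDist hA hD
  have hAD' : sphDist A D = sphDist A C - s * sphDist A C := by linarith
  have hb0 : 0 ≤ sphDist A C := Real.arccos_nonneg _
  rw [hdist] at hDC
  rw [hAD', Real.cos_sub] at hAD
  generalize sphDist A C = b at *
  rcases hb0.eq_or_lt with rfl | hb0
  · refine ⟨0, by simp, by simp, ?_, ?_⟩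
    · simp only [Real.cos_zero, Real.sin_zero, one_smul, smul_zero, add_zero] at *
      exact (inner_eq_one_iff_of_norm_eq_one hA hC).1 hAC.symm
    · simp only [mul_zero, Real.cos_zero, Real.sin_zero, one_smul, smul_zero, add_zero] at *
      exact (inner_eq_one_iff_of_norm_eq_one hD hC).1 hDC.symm
  have hsb : Real.sin b ≠ 0 :=
    (Real.sin_pos_of_pos_of_lt_pi hb0 (by linarith [Real.pi_pos])).ne'
  have hAA : ⟪A, A⟫ = 1 := by rw [real_inner_self_eq_norm_sq, hA]; norm_num
  have hCC : ⟪C, C⟫ = 1 := by rw [real_inner_self_eq_norm_sq, hC]; norm_num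
  have hDD : ⟪D, D⟫ = 1 := by rw [real_inner_self_eq_norm_sq, hD]; norm_num
  obtain ⟨U, hU⟩ : ∃ U, U = (Real.sin b)⁻¹ • (A - Real.cos b • C) := ⟨_, rfl⟩
  have hUC : ⟪U, C⟫ = 0 := by
    rw [hU]
    simp only [inner_smul_left, inner_sub_left, hCC, ← hAC]
    simp
  have hUU : ⟪U, U⟫ = 1 := by
    rw [hU]
    simp only [inner_smul_left, inner_sub_left, inner_smul_right, inner_sub_right, hCC, hAA,
      real_inner_comm A C, ← hAC]
    simp only [conj_trivial]
    field_simp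
    linarith [Real.sin_sq_add_cos_sq b]
  have hUD : ⟪U, D⟫ = Real.sin (s * b) := by
    rw [hU]
    simp only [inner_smul_left, inner_sub_left, real_inner_comm D C, ← hAD, ← hDC]
    simp only [conj_trivial]
    field_simp
    ring
  refine ⟨U, ?_, hUC, ?_, ?_⟩
  · rw [real_inner_self_eq_norm_sq] at hUU
    nlinarith [norm_nonneg U]
  · rw [hU, smul_smul, mul_inv_cancel₀ hsb, one_smul]
    abel
  · rw [← sub_eq_zero, ← inner_self_eq_zero (𝕜 := ℝ)]
    simp only [inner_smul_left, inner_sub_left, inner_add_left, inner_smul_right,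
      inner_sub_right, inner_add_right, hCC, hDD, hUU, hUC, hUD, ← hDC]
    simp only [conj_trivial]
    have hUC' : ⟪C, U⟫ = 0 := by rw [real_inner_comm]; exact hUC
    have hDC' : ⟪C, D⟫ = Real.cos (s * b) := by rw [real_inner_comm]; exact hDC.symm
    have hUD' : ⟪D, U⟫ = Real.sin (s * b) := by rw [real_inner_comm]; exact hUD
    simp only [hUC, hUC', hDC', hUD', hUD, ← hDC]
    linarith [Real.sin_sq_add_cos_sq (s * b)]

theorem aux_inner {C U V : EuclideanSpace ℝ (Fin 3)} (hC : ‖C‖ = 1) (hU : ⟪U, C⟫ = 0)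
    (hV : ⟪V, C⟫ = 0) (x y : ℝ) :
    ⟪Real.cos x • C + Real.sin x • U, Real.cos y • C + Real.sin y • V⟫ =
      Real.cos (x - y) - Real.sin x * Real.sin y * (1 - ⟪U, V⟫) := by
  have hCC : ⟪C, C⟫ = 1 := by rw [real_inner_self_eq_norm_sq, hC]; norm_num
  have hV' : ⟪C, V⟫ = 0 := by rw [real_inner_comm]; exact hV
  simp only [inner_smul_left, inner_add_left, inner_smul_right, inner_add_right, hCC, hU, hV',
    conj_trivial, Real.cos_sub]
  ring

/-- Lemma 3.2: in a spherical triangle `A B C` with sides at most `M ≤ π/2`, if `D` and `E`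
lie on the sides `[A,C]` and `[B,C]` with `d(D,C) = (1-t)·d(A,C)` and `d(E,C) = (1-t)·d(B,C)`,
then `d(D,E) ≤ (sin((1-t)M)/sin M) · d(A,B)`. -/
theorem sph_contraction (A B C D E : EuclideanSpace ℝ (Fin 3)) (M t : ℝ)
    (hA : ‖A‖ = 1) (hB : ‖B‖ = 1) (hC : ‖C‖ = 1) (hD : ‖D‖ = 1) (hE : ‖E‖ = 1)
    (hM0 : 0 < M) (hMpi : M ≤ π / 2)
    (hAB : sphDist A B ≤ M) (hAC : sphDist A C ≤ M) (hBC : sphDist B C ≤ M)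
    (ht : t ∈ Set.Ioo (0 : ℝ) 1)
    (hDgeo : sphDist A D + sphDist D C = sphDist A C)
    (hDdist : sphDist D C = (1 - t) * sphDist A C)
    (hEgeo : sphDist B E + sphDist E C = sphDist B C)
    (hEdist : sphDist E C = (1 - t) * sphDist B C) :
    sphDist D E ≤ (Real.sin ((1 - t) * M) / Real.sin M) * sphDist A B := by
  obtain ⟨ht0, ht1⟩ := ht
  have hpi := Real.pi_pos
  obtain ⟨U, hU1, hUC, hAU, hDU⟩ := aux_decomp A C D (1 - t) hA hC hD (hAC.trans hMpi) hDgeo hDdist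
  obtain ⟨V, hV1, hVC, hBV, hEV⟩ := aux_decomp B C E (1 - t) hB hC hE (hBC.trans hMpi) hEgeo hEdist
  have hb0 : 0 ≤ sphDist A C := Real.arccos_nonneg _
  have ha0 : 0 ≤ sphDist B C := Real.arccos_nonneg _
  have hc0 : 0 ≤ sphDist A B := Real.arccos_nonneg _
  have hcpi : sphDist A B ≤ π := Real.arccos_le_pi _
  have hcosc := aux_cos_sphDist hA hB
  have e1 : ⟪A, B⟫ = _ :=
    (congrArg₂ (fun x y => ⟪x, y⟫) hAU hBV).trans (aux_inner hC hUC hVC _ _)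
  have e2 : ⟪D, E⟫ = _ :=
    (congrArg₂ (fun x y => ⟪x, y⟫) hDU hEV).trans (aux_inner hC hUC hVC _ _)
  have hq : 0 ≤ 1 - ⟪U, V⟫ := by
    have h1 := real_inner_le_norm U V
    nlinarith [norm_nonneg U, norm_nonneg V]
  rw [e1] at hcosc
  have key : Real.cos (Real.sin ((1 - t) * M) / Real.sin M * sphDist A B) ≤ ⟪D, E⟫ ∧
      0 ≤ Real.sin ((1 - t) * M) / Real.sin M ∧ Real.sin ((1 - t) * M) / Real.sin M ≤ 1 := by
    rw [e2]
    clear e1 e2 hDgeo hDdist hEgeo hEdist hAU hBV hDU hEV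
    generalize sphDist A B = c at *
    generalize sphDist A C = b at *
    generalize sphDist B C = a at *
    generalize 1 - ⟪U, V⟫ = q at *
    have hs0 : 0 ≤ 1 - t := by linarith
    have hs1 : 1 - t ≤ 1 := by linarith
    generalize 1 - t = s at *
    have hra := aux_ratio hs0 hs1 ha0 hBC hM0 hMpi
    have hrb := aux_ratio hs0 hs1 hb0 hAC hM0 hMpi
    have hsM : 0 < Real.sin M := Real.sin_pos_of_pos_of_lt_pi hM0 (by linarith)
    have hsMM : s * M ≤ M := by nlinarith
    have hsM0 : 0 ≤ s * M := by positivity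
    have hsk : s ≤ Real.sin (s * M) / Real.sin M := by
      rw [le_div_iff₀ hsM]
      exact aux_sin_concave hs0 hs1 hM0.le (by linarith)
    have hk1 : Real.sin (s * M) / Real.sin M ≤ 1 := by
      rw [div_le_one hsM]
      exact Real.sin_le_sin_of_le_of_le_pi_div_two (by linarith) hMpi hsMM
    generalize Real.sin (s * M) / Real.sin M = k at *
    have hk0 : 0 ≤ k := hs0.trans hsk
    refine ⟨?_, hk0, hk1⟩
    have hsa : 0 ≤ Real.sin a := Real.sin_nonneg_of_nonneg_of_le_pi ha0 (by linarith)
    have hsb : 0 ≤ Real.sin b := Real.sin_nonneg_of_nonneg_of_le_pi hb0 (by linarith)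
    have hssa : 0 ≤ Real.sin (s * a) :=
      Real.sin_nonneg_of_nonneg_of_le_pi (by positivity) (by nlinarith)
    have habs : |b - a| ≤ π := by rw [abs_le]; constructor <;> linarith
    have hle : |b - a| ≤ c := by
      by_contra! hlt
      have := Real.cos_lt_cos_of_nonneg_of_le_pi hc0 habs hlt
      rw [Real.cos_abs] at this
      have : 0 ≤ Real.sin b * Real.sin a * q := by positivity
      linarith
    have hF := aux_F hk0 hk1 (abs_nonneg (b - a)) hle hcpi
    rw [Real.cos_abs] at hF
    have h3 : Real.cos (k * |b - a|) ≤ Real.cos (s * b - s * a) := by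
      rw [← Real.cos_abs (s * b - s * a), ← mul_sub, abs_mul, abs_of_nonneg hs0]
      have h0 := abs_nonneg (b - a)
      apply Real.cos_le_cos_of_nonneg_of_le_pi (by positivity) (by nlinarith)
      exact mul_le_mul_of_nonneg_right hsk h0
    have h4 : Real.sin (s * b) * Real.sin (s * a) * q ≤
        (k * Real.sin b) * (k * Real.sin a) * q := by
      gcongr
    have h5 : (k * Real.sin b) * (k * Real.sin a) * q = k ^ 2 * (Real.sin b * Real.sin a * q) := by
      ring
    rw [h5, show Real.sin b * Real.sin a * q = Real.cos (b - a) - Real.cos c by linarith] at h4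
    linarith
  obtain ⟨key, hk0, hk1⟩ := key
  calc sphDist D E ≤ Real.arccos (Real.cos (Real.sin ((1 - t) * M) / Real.sin M * sphDist A B)) :=
        Real.arccos_le_arccos key
    _ = _ := Real.arccos_cos (mul_nonneg hk0 hc0)
        ((mul_le_of_le_one_left hc0 hk1).trans hcpi)
end

section
/- Let (s_n) be a sequence of non-negative real numbers, and let (α_n), (β_n), (γ_n) be sequences of real numbers satisfying: s_{n+1} ≤ (1 − α_n)·s_n + α_n·β_n + γ_n for all n; α_n ∈ [0,1] for all n and Σ α_n = ∞; limsup_{n→∞} β_n ≤ 0; and γ_n ≥ 0 for all n with Σ γ_n < ∞. Then lim_{n→∞} s_n = 0. -/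
open Filter

/-- Xu's lemma on sequences of nonnegative real numbers: if
`s_{n+1} ≤ (1 - α_n) s_n + α_n β_n + γ_n` with `α_n ∈ [0,1]`, `Σ α_n = ∞`,
`limsup β_n ≤ 0`, `γ_n ≥ 0` and `Σ γ_n < ∞`, then `s_n → 0`. -/
theorem xu_lemma (s α β γ : ℕ → ℝ)
    (hs : ∀ n, 0 ≤ s n)
    (hrec : ∀ n, s (n + 1) ≤ (1 - α n) * s n + α n * β n + γ n)
    (hα : ∀ n, α n ∈ Set.Icc (0 : ℝ) 1)
    (hαdiv : Tendsto (fun N => ∑ n ∈ Finset.range N, α n) atTop atTop)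
    (hβ : Filter.limsup (fun n => (β n : EReal)) atTop ≤ 0)
    (hγ : ∀ n, 0 ≤ γ n)
    (hγsum : Summable γ) :
    Tendsto s atTop (nhds 0) := by
  rw [Metric.tendsto_atTop]
  intro ε' hε'
  obtain ⟨ε, hε, rfl⟩ : ∃ ε : ℝ, 0 < ε ∧ ε' = 3 * ε := ⟨ε' / 3, by positivity, by ring⟩
  have h1 : ∀ᶠ n in atTop, β n < ε := by
    have h0 : Filter.limsup (fun n => (β n : EReal)) atTop < (ε : EReal) :=
      lt_of_le_of_lt hβ (by exact_mod_cast hε)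
    filter_upwards [Filter.eventually_lt_of_limsup_lt h0] with n hn
    exact_mod_cast hn
  have h2 : ∀ᶠ n in atTop, ∑' k, γ (k + n) < ε :=
    (tendsto_sum_nat_add γ).eventually (gt_mem_nhds hε)
  obtain ⟨N, hN⟩ := eventually_atTop.1 (h1.and h2)
  have hb : ∀ n, N ≤ n → β n < ε := fun n hn => (hN n hn).1
  have hg : ∀ k, ∑ i ∈ Finset.range k, γ (N + i) < ε := by
    intro k
    refine lt_of_le_of_lt ?_ (hN N le_rfl).2
    have := ((summable_nat_add_iff N).2 hγsum).sum_le_tsum (Finset.range k) (fun i _ => hγ (i + N))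
    simpa [add_comm] using this
  have key : ∀ k, s (N + k) ≤ ε + Real.exp (-∑ i ∈ Finset.range k, α (N + i)) * s N
      + ∑ i ∈ Finset.range k, γ (N + i) := by
    intro k
    induction k with
    | zero => simp; exact hε.le
    | succ k ih =>
      rw [Finset.sum_range_succ, Finset.sum_range_succ, neg_add, Real.exp_add]
      have hr := hrec (N + k)
      obtain ⟨ha0, ha1⟩ := hα (N + k)
      have hbk := hb (N + k) (by omega)
      have he : 1 - α (N + k) ≤ Real.exp (-α (N + k)) := by
        have := Real.add_one_le_exp (-α (N + k)); linarith
      have hG : 0 ≤ ∑ i ∈ Finset.range k, γ (N + i) := Finset.sum_nonneg fun i _ => hγ _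
      have hE : 0 ≤ Real.exp (-∑ i ∈ Finset.range k, α (N + i)) * s N :=
        mul_nonneg (Real.exp_pos _).le (hs N)
      have e1 := mul_le_mul_of_nonneg_left ih (sub_nonneg.2 ha1)
      have e2 := mul_le_mul_of_nonneg_left hbk.le ha0
      have e3 := mul_le_mul_of_nonneg_right he hE
      have e4 := mul_nonneg ha0 hG
      rw [← add_assoc]
      linarith
  have hT : Tendsto (fun k => ∑ i ∈ Finset.range k, α (N + i)) atTop atTop := by
    have h3 := tendsto_atTop_add_const_right atTop (-∑ n ∈ Finset.range N, α n)
      (hαdiv.comp (tendsto_add_atTop_nat N))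
    refine h3.congr fun k => ?_
    simp only [Function.comp]
    rw [add_comm k N, Finset.sum_range_add]
    ring
  have hL : Tendsto (fun k => Real.exp (-∑ i ∈ Finset.range k, α (N + i)) * s N) atTop (nhds 0) := by
    simpa using (Real.tendsto_exp_neg_atTop_nhds_zero.comp hT).mul_const (s N)
  obtain ⟨K, hK⟩ := eventually_atTop.1 (hL.eventually (gt_mem_nhds hε))
  refine ⟨N + K, fun n hn => ?_⟩
  obtain ⟨k, rfl⟩ := Nat.exists_eq_add_of_le (show N ≤ n by omega)
  rw [Real.dist_eq, sub_zero, abs_of_nonneg (hs _)]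
  have := hK k (by omega)
  linarith [key k, hg k]
end

section
/- For every M ∈ (0,π/2), every θ ∈ (0,1) and every t ∈ (0,1), one has sin((1−t)M) + θ·cos M·sin(tM) ≤ (1 − t(1−θ)·cos M)·sin M; equivalently, sin((1−t)M)/sin M + θ·cos M·(sin(tM)/sin M) ≤ 1 − t(1−θ)·cos M. -/
open Real

/-- For `M ∈ (0, π/2)`, `θ ∈ (0,1)` and `t ∈ (0,1)`,
`sin((1−t)M) + θ·cos M·sin(tM) ≤ (1 − t(1−θ)·cos M)·sin M`; equivalently,
`sin((1−t)M)/sin M + θ·cos M·(sin(tM)/sin M) ≤ 1 − t(1−θ)·cos M`. -/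
theorem sin_combination_bound (M θ t : ℝ)
    (hM : M ∈ Set.Ioo (0 : ℝ) (π / 2))
    (hθ : θ ∈ Set.Ioo (0 : ℝ) 1) (ht : t ∈ Set.Ioo (0 : ℝ) 1) :
    Real.sin ((1 - t) * M) + θ * Real.cos M * Real.sin (t * M) ≤
        (1 - t * (1 - θ) * Real.cos M) * Real.sin M ∧
      Real.sin ((1 - t) * M) / Real.sin M + θ * Real.cos M * (Real.sin (t * M) / Real.sin M) ≤
        1 - t * (1 - θ) * Real.cos M := by
  obtain ⟨hM0, hM1⟩ := hM
  obtain ⟨hθ0, hθ1⟩ := hθ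
  obtain ⟨ht0, ht1⟩ := ht
  have hs : 0 < Real.sin M := Real.sin_pos_of_pos_of_lt_pi hM0 (by linarith)
  have hc : 0 < Real.cos M := Real.cos_pos_of_mem_Ioo ⟨by linarith, hM1⟩
  have hconc : t * Real.sin M ≤ Real.sin (t * M) := by
    have h := strictConcaveOn_sin_Icc.concaveOn.2
      (show (0 : ℝ) ∈ Set.Icc 0 π from ⟨le_refl _, Real.pi_pos.le⟩)
      (show M ∈ Set.Icc 0 π from ⟨hM0.le, by linarith⟩)
      (show 0 ≤ 1 - t by linarith) ht0.le (by ring)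
    simpa using h
  have key : Real.sin ((1 - t) * M) + θ * Real.cos M * Real.sin (t * M) ≤
      (1 - t * (1 - θ) * Real.cos M) * Real.sin M := by
    have e : (1 - t) * M = M - t * M := by ring
    rw [e, Real.sin_sub]
    have h1 : Real.sin M * Real.cos (t * M) ≤ Real.sin M * 1 :=
      mul_le_mul_of_nonneg_left (Real.cos_le_one _) hs.le
    have h2 := mul_le_mul_of_nonneg_left hconc
      (mul_nonneg (sub_nonneg.2 hθ1.le) hc.le)
    linarith
  refine ⟨key, ?_⟩
  have e2 : Real.sin ((1 - t) * M) / Real.sin M + θ * Real.cos M * (Real.sin (t * M) / Real.sin M)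
      = (Real.sin ((1 - t) * M) + θ * Real.cos M * Real.sin (t * M)) / Real.sin M := by ring
  rw [e2, div_le_iff₀ hs]
  exact key
end
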